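/- arXiv:0908.1138 — 2 statements merged into one kernel-verified Lean document; each statement's English description precedes it below -/
import Mathlib

section
/- Let c₁, c₂ : ℝ → ℝ² be two continuous injective proper curves, each contained between two parallel lines of some fixed direction (with orientation), such that c₁ and c₂ intersect exactly once and transversely. If h₁, h₂ ∈ ℝ² \ {0} are the direction vectors of the strips containing c₁ and c₂ respectively, and h₁, h₂ are linearly independent, then the sign of the oriented intersection of c₁ and c₂ at their intersection point equals the sign of det(h₁, h₂). -/
open Filter Topology

/-- The determinant of two planar vectors. -/
def det2 (u v : ℝ × ℝ) : ℝ := u.1 * v.2 - u.2 * v.1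

/-- The dot product of two planar vectors. -/
def dot2 (u v : ℝ × ℝ) : ℝ := u.1 * v.1 + u.2 * v.2

lemma exp_const_aux (f : ℝ → ℂ) (hf : Continuous f) (h : ∀ t, Complex.exp (f t) = 1) (a b : ℝ) :
    f a = f b := by
  refine Complex.isCoveringMap_exp.const_of_comp hf ?_ a b
  intro a a'
  simp [h]

lemma turn_aux (l φ q : ℝ → ℂ) (hl : Continuous l) (hφ : Continuous φ) (hq : Continuous q)
    (hs : ∀ t, q t ∈ Complex.slitPlane)
    (h : ∀ t, Complex.exp (l t) = Complex.exp (φ t) * q t) (a b : ℝ) (hab : q a = q b) :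
    l b - l a = φ b - φ a := by
  have := exp_const_aux (fun t => l t - φ t - Complex.log (q t))
    ((hl.sub hφ).sub (hq.clog hs)) (fun t => by
      have h0 := Complex.slitPlane_ne_zero (hs t)
      rw [Complex.exp_sub, Complex.exp_sub, Complex.exp_log h0, h t]
      field_simp [Complex.exp_ne_zero]) a b
  simp only [hab] at this
  linear_combination -this

lemma polar_aux (G : ℂ → ℂ) (hG : Continuous G) (h0 : ∀ z, z ≠ 0 → G z ≠ 0)
    (r₀ r₁ : ℝ) (hr₀ : 0 < r₀) (hr₁ : 0 < r₁) (b : ℂ) (hb : b ≠ 0)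
    (H₀ : ∀ z : ℂ, ‖z‖ = r₀ → G z / z ∈ Complex.slitPlane)
    (H₁ : ∀ z : ℂ, ‖z‖ = r₁ → G z / (b * (starRingEnd ℂ) z) ∈ Complex.slitPlane) : False := by
  have hne : ∀ w : ℂ, G (Complex.exp w) ≠ 0 := fun w => h0 _ (Complex.exp_ne_zero _)
  obtain ⟨L, ⟨-, hL⟩, -⟩ := Complex.isCoveringMapOn_exp.existsUnique_continuousMap_lifts
    (⟨fun w : ℂ => G (Complex.exp w), by fun_prop⟩ : C(ℂ, ℂ)) (a₀ := 0)
    (Complex.exp_log (hne 0)) (fun a => hne a)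
  have hL' : ∀ w, Complex.exp (L w) = G (Complex.exp w) := fun w => congrFun hL w
  have hLc : Continuous L := L.continuous
  have hper : ∀ w : ℂ, Complex.exp (w + (2 * Real.pi : ℝ) * Complex.I) = Complex.exp w := by
    intro w
    push_cast
    exact Complex.exp_periodic w
  have key := exp_const_aux
    (fun r => L (r + (2 * Real.pi : ℝ) * Complex.I) - L (r + (0 : ℝ) * Complex.I))
    (by fun_prop) (fun r => by
      rw [Complex.exp_sub, hL', hL', hper]
      simp only [Complex.ofReal_zero, zero_mul, add_zero]
      exact div_self (hne _)) (Real.log r₀) (Real.log r₁)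
  have hnorm : ∀ r : ℝ, 0 < r → ∀ t : ℝ,
      ‖Complex.exp ((Real.log r : ℝ) + (t : ℂ) * Complex.I)‖ = r := by
    intro r hr t
    rw [Complex.norm_exp]
    simp [Real.exp_log hr]
  have k0 := turn_aux (fun t => L ((Real.log r₀ : ℝ) + (t : ℂ) * Complex.I))
    (fun t => (Real.log r₀ : ℝ) + (t : ℂ) * Complex.I)
    (fun t => G (Complex.exp ((Real.log r₀ : ℝ) + (t : ℂ) * Complex.I)) /
      Complex.exp ((Real.log r₀ : ℝ) + (t : ℂ) * Complex.I))
    (by fun_prop) (by fun_prop)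
    (Continuous.div (by fun_prop) (by fun_prop) (fun t => Complex.exp_ne_zero _))
    (fun t => H₀ _ (hnorm r₀ hr₀ t))
    (fun t => by rw [hL', mul_div_cancel₀ _ (Complex.exp_ne_zero _)]) 0 (2 * Real.pi)
    (by simp only [hper]; simp)
  have hconj : ∀ w : ℂ, b * (starRingEnd ℂ) (Complex.exp w) ≠ 0 := fun w =>
    mul_ne_zero hb (by simp)
  have k1 := turn_aux (fun t => L ((Real.log r₁ : ℝ) + (t : ℂ) * Complex.I))
    (fun t => Complex.log b + (starRingEnd ℂ) ((Real.log r₁ : ℝ) + (t : ℂ) * Complex.I))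
    (fun t => G (Complex.exp ((Real.log r₁ : ℝ) + (t : ℂ) * Complex.I)) /
      (b * (starRingEnd ℂ) (Complex.exp ((Real.log r₁ : ℝ) + (t : ℂ) * Complex.I))))
    (by fun_prop) (by fun_prop)
    (Continuous.div (by fun_prop) (by fun_prop) (fun t => hconj _))
    (fun t => H₁ _ (hnorm r₁ hr₁ t))
    (fun t => by
      rw [hL', Complex.exp_add (Complex.log b), Complex.exp_log hb, Complex.exp_conj,
        mul_div_cancel₀ _ (hconj _)]) 0 (2 * Real.pi)
    (by simp only [hper]; simp)
  rw [k0, k1] at key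
  have := congrArg Complex.im key
  simp [-Complex.ofReal_log] at this
  have := Real.pi_pos
  linarith

lemma grow_aux (c : ℝ → ℝ × ℝ) (h k : ℝ × ℝ) (l : Filter ℝ)
    (hstrip : ∃ C : ℝ, ∀ t, |det2 (c t) h| ≤ C) (hne : det2 h k ≠ 0) (K : ℝ) :
    (Tendsto (fun t => dot2 (c t) h) l atTop → ∀ᶠ t in l, K < det2 h k * det2 (c t) k) ∧
    (Tendsto (fun t => dot2 (c t) h) l atBot → ∀ᶠ t in l, det2 h k * det2 (c t) k < K) := by
  obtain ⟨C, hC⟩ := hstrip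
  have hD : 0 < det2 h k ^ 2 := by positivity
  have hN : 0 < dot2 h h := by
    by_contra hcon
    apply hne
    have h1 : h.1 = 0 := by unfold dot2 at hcon; nlinarith [sq_nonneg h.1, sq_nonneg h.2]
    have h2 : h.2 = 0 := by unfold dot2 at hcon; nlinarith [sq_nonneg h.1, sq_nonneg h.2]
    simp [det2, h1, h2]
  have id1 : ∀ t, det2 h k * det2 (c t) k * dot2 h h =
      dot2 (c t) h * det2 h k ^ 2 + det2 h k * dot2 h k * det2 (c t) h := by
    intro t; unfold det2 dot2; ring
  have bd : ∀ t, |det2 h k * dot2 h k * det2 (c t) h| ≤ |det2 h k * dot2 h k| * C := by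
    intro t
    rw [abs_mul]
    exact mul_le_mul_of_nonneg_left (hC t) (abs_nonneg _)
  set M := |det2 h k * dot2 h k| * C
  constructor
  · intro hT
    filter_upwards [hT.eventually_gt_atTop ((K * dot2 h h + M) / det2 h k ^ 2)] with t ht
    rw [div_lt_iff₀ hD] at ht
    have := (abs_le.1 (bd t)).1
    have e := id1 t
    exact lt_of_mul_lt_mul_right (by linarith) hN.le
  · intro hT
    filter_upwards [hT.eventually_lt_atBot ((K * dot2 h h - M) / det2 h k ^ 2)] with t ht
    rw [lt_div_iff₀ hD] at ht
    have := (abs_le.1 (bd t)).2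
    have e := id1 t
    exact lt_of_mul_lt_mul_right (by linarith) hN.le

/-- complex coordinates of a planar vector in the frame dual to `h, k` -/
def frm (h k p : ℝ × ℝ) : ℂ := ⟨det2 p k, det2 h p⟩

lemma frm_sub (h k p q : ℝ × ℝ) : frm h k (p - q) = frm h k p - frm h k q := by
  apply Complex.ext <;> simp [frm, det2] <;> ring

lemma frm_cont (h k : ℝ × ℝ) (c : ℝ → ℝ × ℝ) (hc : Continuous c) :
    Continuous (fun t => frm h k (c t)) := by
  have : (fun t => frm h k (c t)) =
      fun t => ((det2 (c t) k : ℝ) : ℂ) + ((det2 h (c t) : ℝ) : ℂ) * Complex.I := by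
    funext t; apply Complex.ext <;> simp [frm]
  rw [this]
  unfold det2
  fun_prop

lemma frm_deriv (h k : ℝ × ℝ) (c : ℝ → ℝ × ℝ) (v : ℝ × ℝ) (t : ℝ) (hc : HasDerivAt c v t) :
    HasDerivAt (fun t => frm h k (c t)) (frm h k v) t := by
  have e : ∀ p, frm h k p =
      ((p.1 * k.2 - p.2 * k.1 : ℝ) : ℂ) + ((h.1 * p.2 - h.2 * p.1 : ℝ) : ℂ) * Complex.I := by
    intro p; apply Complex.ext <;> simp [frm, det2]
  have h1 : HasDerivAt (fun t => (c t).1) v.1 t := hc.fst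
  have h2 : HasDerivAt (fun t => (c t).2) v.2 t := hc.snd
  simp only [e]
  exact (((h1.mul_const k.2).sub (h2.mul_const k.1)).ofReal_comp).add
    ((((h2.const_mul h.1).sub (h1.const_mul h.2)).ofReal_comp).mul_const Complex.I)

lemma frm_small (h k : ℝ × ℝ) (c : ℝ → ℝ × ℝ) (v : ℝ × ℝ) (t : ℝ) (hc : HasDerivAt c v t)
    (ε : ℝ) (hε : 0 < ε) : ∃ δ > 0, ∀ x : ℝ, |x| < δ →
      ‖frm h k (c (t + x)) - frm h k (c t) - x * frm h k v‖ ≤ ε * |x| := by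
  have := (hasDerivAt_iff_isLittleO_nhds_zero.1 (frm_deriv h k c v t hc)).def hε
  obtain ⟨δ, hδ, H⟩ := Metric.eventually_nhds_iff.1 this
  refine ⟨δ, hδ, fun x hx => ?_⟩
  have := H (y := x) (by simpa using hx)
  simpa using this

lemma pos_case (c₁ c₂ : ℝ → ℝ × ℝ) (h₁ h₂ : ℝ × ℝ)
    (hc₁ : Continuous c₁) (hc₂ : Continuous c₂)
    (hstrip₁ : ∃ C : ℝ, ∀ t, |det2 (c₁ t) h₁| ≤ C)
    (hstrip₂ : ∃ C : ℝ, ∀ t, |det2 (c₂ t) h₂| ≤ C)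
    (horient₁ : Tendsto (fun t => dot2 (c₁ t) h₁) atTop atTop ∧
      Tendsto (fun t => dot2 (c₁ t) h₁) atBot atBot)
    (horient₂ : Tendsto (fun t => dot2 (c₂ t) h₂) atTop atTop ∧
      Tendsto (fun t => dot2 (c₂ t) h₂) atBot atBot)
    (hindep : 0 < det2 h₁ h₂)
    (t₁ t₂ : ℝ) (v₁ v₂ : ℝ × ℝ)
    (hder₁ : HasDerivAt c₁ v₁ t₁) (hder₂ : HasDerivAt c₂ v₂ t₂)
    (hmeet : c₁ t₁ = c₂ t₂)
    (htrans : det2 v₁ v₂ ≠ 0)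
    (huniq : ∀ s u : ℝ, c₁ s = c₂ u → s = t₁ ∧ u = t₂) : 0 < det2 v₁ v₂ := by
  by_contra hcon
  have hneg : det2 v₁ v₂ < 0 := lt_of_le_of_ne (not_lt.1 hcon) htrans
  set f := frm h₁ h₂ with hf
  have hfinj : ∀ p q, f p = f q → p = q := by
    intro p q hpq
    have e1 : det2 p h₂ = det2 q h₂ := congrArg Complex.re hpq
    have e2 : det2 h₁ p = det2 h₁ q := congrArg Complex.im hpq
    unfold det2 at e1 e2 hindep
    apply Prod.ext
    · apply mul_left_cancel₀ hindep.ne'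
      linear_combination h₁.1 * e1 + h₂.1 * e2
    · apply mul_left_cancel₀ hindep.ne'
      linear_combination h₁.2 * e1 + h₂.2 * e2
  set G : ℂ → ℂ := fun z => f (c₁ (t₁ + z.re)) - f (c₂ (t₂ + -z.im)) with hG
  have hGc : Continuous G := by
    have a1 := frm_cont h₁ h₂ c₁ hc₁
    have a2 := frm_cont h₁ h₂ c₂ hc₂
    exact (a1.comp (continuous_const.add Complex.continuous_re)).sub
      (a2.comp (continuous_const.add Complex.continuous_im.neg))
  have hG0 : ∀ z, z ≠ 0 → G z ≠ 0 := by
    intro z hz h0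
    obtain ⟨e1, e2⟩ := huniq _ _ (hfinj _ _ (sub_eq_zero.1 h0))
    apply hz
    apply Complex.ext <;> simp <;> linarith
  -- large scale
  obtain ⟨C₁, hC₁⟩ := hstrip₁
  obtain ⟨C₂, hC₂⟩ := hstrip₂
  have hD' : det2 h₂ h₁ = - det2 h₁ h₂ := by unfold det2; ring
  have hD'' : det2 h₂ h₁ ≠ 0 := by rw [hD']; linarith
  obtain ⟨R1, hR1⟩ := eventually_atTop.1
    ((grow_aux c₁ h₁ h₂ atTop ⟨C₁, hC₁⟩ hindep.ne' (det2 h₁ h₂ * C₂)).1 horient₁.1)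
  obtain ⟨R2, hR2⟩ := eventually_atBot.1
    ((grow_aux c₁ h₁ h₂ atBot ⟨C₁, hC₁⟩ hindep.ne' (-(det2 h₁ h₂ * C₂))).2 horient₁.2)
  obtain ⟨R3, hR3⟩ := eventually_atTop.1
    ((grow_aux c₂ h₂ h₁ atTop ⟨C₂, hC₂⟩ hD'' (det2 h₁ h₂ * C₁)).1 horient₂.1)
  obtain ⟨R4, hR4⟩ := eventually_atBot.1
    ((grow_aux c₂ h₂ h₁ atBot ⟨C₂, hC₂⟩ hD'' (-(det2 h₁ h₂ * C₁))).2 horient₂.2)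
  have hre : ∀ z : ℂ, (G z).re = det2 (c₁ (t₁ + z.re)) h₂ - det2 (c₂ (t₂ + -z.im)) h₂ :=
    fun z => rfl
  have him : ∀ z : ℂ, (G z).im = det2 (c₂ (t₂ + -z.im)) h₁ - det2 (c₁ (t₁ + z.re)) h₁ := by
    intro z
    have : (G z).im = det2 h₁ (c₁ (t₁ + z.re)) - det2 h₁ (c₂ (t₂ + -z.im)) := rfl
    rw [this]; unfold det2; ring
  have B1 : ∀ z : ℂ, R1 - t₁ ≤ z.re → 0 < (G z).re := by
    intro z hz
    have a := lt_of_mul_lt_mul_left (hR1 (t₁ + z.re) (by linarith)) hindep.le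
    have b := (abs_le.1 (hC₂ (t₂ + -z.im))).2
    rw [hre]; linarith
  have B2 : ∀ z : ℂ, z.re ≤ R2 - t₁ → (G z).re < 0 := by
    intro z hz
    have a := hR2 (t₁ + z.re) (by linarith)
    rw [← mul_neg] at a
    have a := lt_of_mul_lt_mul_left a hindep.le
    have b := (abs_le.1 (hC₂ (t₂ + -z.im))).1
    rw [hre]; linarith
  have B3 : ∀ z : ℂ, z.im ≤ t₂ - R3 → (G z).im < 0 := by
    intro z hz
    have a := hR3 (t₂ + -z.im) (by linarith)
    rw [hD', neg_mul, ← mul_neg] at a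
    have a := lt_of_mul_lt_mul_left a hindep.le
    have b := (abs_le.1 (hC₁ (t₁ + z.re))).1
    rw [him]; linarith
  have B4 : ∀ z : ℂ, t₂ - R4 ≤ z.im → 0 < (G z).im := by
    intro z hz
    have a := hR4 (t₂ + -z.im) (by linarith)
    rw [hD', neg_mul, neg_lt_neg_iff] at a
    have a := lt_of_mul_lt_mul_left a hindep.le
    have b := (abs_le.1 (hC₁ (t₁ + z.re))).2
    rw [him]; linarith
  obtain ⟨R, hRpos, hRa, hRb, hRc, hRd⟩ : ∃ R : ℝ, 0 < R ∧ R1 - t₁ ≤ R ∧ -R ≤ R2 - t₁ ∧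
      -R ≤ t₂ - R3 ∧ t₂ - R4 ≤ R := by
    refine ⟨1 + |R1 - t₁| + |R2 - t₁| + |t₂ - R3| + |t₂ - R4|, by positivity, ?_, ?_, ?_, ?_⟩ <;>
    linarith [abs_nonneg (R1 - t₁), abs_nonneg (R2 - t₁), abs_nonneg (t₂ - R3),
      abs_nonneg (t₂ - R4), le_abs_self (R1 - t₁), neg_abs_le (R2 - t₁),
      neg_abs_le (t₂ - R3), le_abs_self (t₂ - R4)]
  have H₀ : ∀ z : ℂ, ‖z‖ = 2 * R → G z / z ∈ Complex.slitPlane := by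
    intro z hz
    have hz0 : z ≠ 0 := by
      rintro rfl
      simp at hz
      linarith
    by_contra hns
    rw [Complex.mem_slitPlane_iff] at hns
    push Not at hns
    obtain ⟨hq1, hq2⟩ := hns
    have hGz : G z = (G z / z) * z := by field_simp
    set q := G z / z
    have er : (G z).re = q.re * z.re := by rw [hGz, Complex.mul_re, hq2]; ring
    have ei : (G z).im = q.re * z.im := by rw [hGz, Complex.mul_im, hq2]; ring
    have hle := Complex.norm_le_abs_re_add_abs_im z
    rw [hz] at hle
    rcases le_or_gt R |z.re| with hx | hx
    · rcases le_abs.1 hx with hx | hx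
      · have := B1 z (by linarith)
        nlinarith
      · have := B2 z (by linarith)
        nlinarith
    · have hy : R ≤ |z.im| := by linarith
      rcases le_abs.1 hy with hy | hy
      · have := B4 z (by linarith)
        nlinarith
      · have := B3 z (by linarith)
        nlinarith
  -- small scale
  set P := f v₁ with hP
  set Q := f v₂ with hQ
  set a : ℂ := (P - Complex.I * Q) / 2 with ha
  set b : ℂ := (P + Complex.I * Q) / 2 with hb
  have hab : ‖a‖ < ‖b‖ := by
    have : ‖b‖ ^ 2 - ‖a‖ ^ 2 = -(det2 h₁ h₂ * det2 v₁ v₂) := by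
      rw [← Complex.normSq_eq_norm_sq, ← Complex.normSq_eq_norm_sq, Complex.normSq_apply,
        Complex.normSq_apply]
      have e2 : ∀ w : ℂ, w / 2 = ((1 / 2 : ℝ) : ℂ) * w := by intro w; push_cast; ring
      rw [ha, hb, e2, e2]
      simp only [Complex.re_ofReal_mul, Complex.im_ofReal_mul, Complex.add_re, Complex.add_im,
        Complex.sub_re, Complex.sub_im, Complex.I_mul_re, Complex.I_mul_im]
      simp only [hP, hQ, hf, frm, det2]
      ring
    have h3 : ‖a‖ ^ 2 < ‖b‖ ^ 2 := by nlinarith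
    exact lt_of_pow_lt_pow_left₀ 2 (norm_nonneg _) h3
  have hb0 : b ≠ 0 := by
    intro h; rw [h, norm_zero] at hab; linarith [norm_nonneg a]
  set ε := (‖b‖ - ‖a‖) / 4 with hε
  have hεpos : 0 < ε := by rw [hε]; linarith
  obtain ⟨δ₁, hδ₁, S₁⟩ := frm_small h₁ h₂ c₁ v₁ t₁ hder₁ ε hεpos
  obtain ⟨δ₂, hδ₂, S₂⟩ := frm_small h₁ h₂ c₂ v₂ t₂ hder₂ ε hεpos
  have hmin : 0 < min δ₁ δ₂ := lt_min hδ₁ hδ₂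
  refine polar_aux G hGc hG0 (2 * R) (min δ₁ δ₂ / 2) (by linarith) (by linarith) b hb0 H₀ ?_
  intro z hz
  have hzpos : 0 < ‖z‖ := by rw [hz]; linarith
  have hxz := Complex.abs_re_le_norm z
  have hyz := Complex.abs_im_le_norm z
  have s1 := S₁ z.re (by linarith [min_le_left δ₁ δ₂])
  have s2 := S₂ (-z.im) (by rw [abs_neg]; linarith [min_le_right δ₁ δ₂])
  rw [abs_neg] at s2
  have hden : b * (starRingEnd ℂ) z ≠ 0 :=
    mul_ne_zero hb0 (by simpa using norm_pos_iff.1 hzpos)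
  have hsplit : G z - b * (starRingEnd ℂ) z = a * z +
      ((f (c₁ (t₁ + z.re)) - f (c₁ t₁) - (z.re : ℂ) * P) -
       (f (c₂ (t₂ + -z.im)) - f (c₂ t₂) - ((-z.im : ℝ) : ℂ) * Q)) := by
    have hz1 : z = z.re + z.im * Complex.I := (Complex.re_add_im z).symm
    have hz2 : (starRingEnd ℂ) z = z.re - z.im * Complex.I := by
      apply Complex.ext <;> simp
    have hlin : a * z + b * (starRingEnd ℂ) z = z.re * P + z.im * Q := by
      rw [hz2]
      nth_rewrite 1 [hz1]
      rw [ha, hb]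
      linear_combination (-(z.im : ℂ) * Q) * Complex.I_sq
    simp only [hG]
    rw [hmeet]
    push_cast
    linear_combination -hlin
  have hlt : ‖G z - b * (starRingEnd ℂ) z‖ < ‖b * (starRingEnd ℂ) z‖ := by
    rw [hsplit]
    have n1 := norm_add_le (a * z) ((f (c₁ (t₁ + z.re)) - f (c₁ t₁) - (z.re : ℂ) * P) -
       (f (c₂ (t₂ + -z.im)) - f (c₂ t₂) - ((-z.im : ℝ) : ℂ) * Q))
    have n2 := norm_sub_le (f (c₁ (t₁ + z.re)) - f (c₁ t₁) - (z.re : ℂ) * P)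
       (f (c₂ (t₂ + -z.im)) - f (c₂ t₂) - ((-z.im : ℝ) : ℂ) * Q)
    rw [norm_mul] at n1
    rw [norm_mul, Complex.norm_conj]
    have m1 : ε * |z.re| ≤ ε * ‖z‖ := mul_le_mul_of_nonneg_left hxz hεpos.le
    have m2 : ε * |z.im| ≤ ε * ‖z‖ := mul_le_mul_of_nonneg_left hyz hεpos.le
    have m3 : ‖a‖ * ‖z‖ + 2 * (ε * ‖z‖) < ‖b‖ * ‖z‖ := by
      rw [hε]; nlinarith
    linarith
  have hq : G z / (b * (starRingEnd ℂ) z) =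
      1 + (G z - b * (starRingEnd ℂ) z) / (b * (starRingEnd ℂ) z) := by
    rw [sub_div (G z), div_self hden]; ring
  rw [hq]
  apply Complex.mem_slitPlane_of_norm_lt_one
  rw [norm_div, div_lt_one (norm_pos_iff.2 hden)]
  exact hlt

/-- planar content of Lemma 8.1: two continuous injective proper curves,
each confined to an oriented strip of direction `h₁` resp. `h₂` (and traversing it in the
positive direction), with `h₁, h₂` linearly independent, intersecting exactly once and
transversely, have oriented intersection sign equal to `sgn (det (h₁, h₂))`. -/
theorem intersection_sign_eq_det_sign (c₁ c₂ : ℝ → ℝ × ℝ) (h₁ h₂ : ℝ × ℝ)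
    (hc₁ : Continuous c₁) (hc₂ : Continuous c₂)
    (hinj₁ : Function.Injective c₁) (hinj₂ : Function.Injective c₂)
    (hprop₁ : Tendsto c₁ (cocompact ℝ) (cocompact (ℝ × ℝ)))
    (hprop₂ : Tendsto c₂ (cocompact ℝ) (cocompact (ℝ × ℝ)))
    (hne₁ : h₁ ≠ 0) (hne₂ : h₂ ≠ 0)
    (hstrip₁ : ∃ C : ℝ, ∀ t, |det2 (c₁ t) h₁| ≤ C)
    (hstrip₂ : ∃ C : ℝ, ∀ t, |det2 (c₂ t) h₂| ≤ C)
    (horient₁ : Tendsto (fun t => dot2 (c₁ t) h₁) atTop atTop ∧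
      Tendsto (fun t => dot2 (c₁ t) h₁) atBot atBot)
    (horient₂ : Tendsto (fun t => dot2 (c₂ t) h₂) atTop atTop ∧
      Tendsto (fun t => dot2 (c₂ t) h₂) atBot atBot)
    (hindep : det2 h₁ h₂ ≠ 0)
    (t₁ t₂ : ℝ) (v₁ v₂ : ℝ × ℝ)
    (hder₁ : HasDerivAt c₁ v₁ t₁) (hder₂ : HasDerivAt c₂ v₂ t₂)
    (hmeet : c₁ t₁ = c₂ t₂)
    (htrans : det2 v₁ v₂ ≠ 0)
    (huniq : ∀ s u : ℝ, c₁ s = c₂ u → s = t₁ ∧ u = t₂) :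
    Real.sign (det2 v₁ v₂) = Real.sign (det2 h₁ h₂) := by
  have hsw : ∀ u v : ℝ × ℝ, det2 v u = - det2 u v := by
    intro u v; unfold det2; ring
  rcases lt_or_gt_of_ne hindep with hlt | hgt
  · have := pos_case c₂ c₁ h₂ h₁ hc₂ hc₁ hstrip₂ hstrip₁ horient₂ horient₁
      (by rw [hsw h₁ h₂]; linarith) t₂ t₁ v₂ v₁ hder₂ hder₁ hmeet.symm
      (by rw [hsw v₁ v₂]; exact neg_ne_zero.2 htrans)
      (fun s u h => (huniq u s h.symm).symm)
    rw [hsw v₁ v₂] at this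
    rw [Real.sign_of_neg hlt, Real.sign_of_neg (by linarith)]
  · have := pos_case c₁ c₂ h₁ h₂ hc₁ hc₂ hstrip₁ hstrip₂ horient₁ horient₂
      hgt t₁ t₂ v₁ v₂ hder₁ hder₂ hmeet htrans huniq
    rw [Real.sign_of_pos hgt, Real.sign_of_pos this]
end

section
/- Let c : ℝ → ℝ® be a curve in ℝ² contained in a strip between two parallel lines, which is proper (preimages of compact sets are compact) and injective. Then c(ℝ) separates the two boundary lines of any open strip containing it: any continuous path from one boundary line of the strip to the other must intersect c(ℝ). -/
open Filter Topology Set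

/-- The argument stays in one half-turn interval as long as the sine does not vanish. -/
theorem confine_sin (g : ℝ → ℝ) (hg : Continuous g) (u v : ℝ) (k : ℤ)
    (hs : ∀ x ∈ uIcc u v, Real.sin (g x) ≠ 0)
    (h1 : k * Real.pi < g u) (h2 : g u < k * Real.pi + Real.pi) :
    k * Real.pi < g v ∧ g v < k * Real.pi + Real.pi := by
  have ivt := intermediate_value_uIcc (a := u) (b := v) (f := g) hg.continuousOn
  constructor
  · by_contra! hlt
    obtain ⟨x, hx, hxe⟩ := ivt (show (k * Real.pi) ∈ uIcc (g u) (g v) from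
      mem_uIcc.2 (Or.inr ⟨hlt, h1.le⟩))
    exact hs x hx (by rw [hxe]; exact Real.sin_int_mul_pi k)
  · by_contra! hlt
    obtain ⟨x, hx, hxe⟩ := ivt (show (k * Real.pi + Real.pi) ∈ uIcc (g u) (g v) from
      mem_uIcc.2 (Or.inl ⟨h2.le, hlt⟩))
    exact hs x hx (by
      rw [hxe, Real.sin_add_pi, Real.sin_int_mul_pi k, neg_zero])

/-- Planar Poincare-Miranda theorem (for a map defined on the whole plane). -/
theorem miranda (F : ℝ × ℝ → ℂ) (hF : Continuous F) (T₀ T₁ : ℝ)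
    (h0 : ∀ t, (F (0, t)).re < 0) (h1 : ∀ t, 0 < (F (1, t)).re)
    (hT0 : ∀ s, 0 < (F (s, T₀)).im) (hT1 : ∀ s, (F (s, T₁)).im < 0) :
    ∃ z, F z = 0 := by
  by_contra! hne
  obtain ⟨G, ⟨hG0, hG⟩, -⟩ := Complex.isCoveringMapOn_exp.existsUnique_continuousMap_lifts
    (A := ℝ × ℝ) ⟨F, hF⟩ (a₀ := (1, T₁)) (e₀ := Complex.log (F (1, T₁)))
    (by simpa using Complex.exp_log (hne _)) (fun z => by simpa using hne z)
  have hexp : ∀ z, Complex.exp (G z) = F z := fun z => congrFun hG z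
  have hGc : Continuous G := G.continuous
  have hre : ∀ z, (F z).re = Real.exp (G z).re * Real.cos (G z).im := fun z => by
    rw [← hexp, Complex.exp_re]
  have him : ∀ z, (F z).im = Real.exp (G z).re * Real.sin (G z).im := fun z => by
    rw [← hexp, Complex.exp_im]
  have c0 : ∀ t, Real.cos (G (0, t)).im < 0 := fun t => by
    have := h0 t
    rw [hre] at this
    exact neg_of_mul_neg_right this (Real.exp_pos _).le
  have c1 : ∀ t, 0 < Real.cos (G (1, t)).im := fun t => by
    have := h1 t
    rw [hre] at this
    exact pos_of_mul_pos_right this (Real.exp_pos _).le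
  have s0 : ∀ t, 0 < Real.sin (G (t, T₀)).im := fun t => by
    have := hT0 t
    rw [him] at this
    exact pos_of_mul_pos_right this (Real.exp_pos _).le
  have s1 : ∀ t, Real.sin (G (t, T₁)).im < 0 := fun t => by
    have := hT1 t
    rw [him] at this
    exact neg_of_mul_neg_right this (Real.exp_pos _).le
  have hpi := Real.pi_pos
  have b1 : (G (1, T₁)).im < 0 := by
    rw [hG0, Complex.log_im]; exact Complex.arg_neg_iff.2 (hT1 1)
  have b2 : -(Real.pi / 2) < (G (1, T₁)).im := by
    rw [hG0, Complex.log_im]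
    exact (abs_lt.1 (Complex.abs_arg_lt_pi_div_two_iff.2 (Or.inl (h1 T₁)))).1
  have e1 := confine_sin (fun s => (G (s, T₁)).im) (by fun_prop) 1 0 (-1)
    (fun x _ => (s1 x).ne) (by push_cast; linarith) (by push_cast; linarith)
  push_cast at e1
  have d1 : (G (0, T₁)).im < -(Real.pi / 2) := by
    by_contra! hh
    have := Real.cos_nonneg_of_neg_pi_div_two_le_of_le hh (by linarith [e1.2])
    linarith [c0 T₁]
  have e2 := confine_sin (fun t => (G (0, t)).im + Real.pi / 2) (by fun_prop) T₁ T₀ (-1)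
    (fun x _ => by rw [Real.sin_add_pi_div_two]; exact (c0 x).ne)
    (by push_cast; linarith [e1.1]) (by push_cast; linarith)
  push_cast at e2
  have d2 : (G (0, T₀)).im < -Real.pi := by
    by_contra! hh
    have := Real.sin_nonpos_of_nonpos_of_neg_pi_le (by linarith [e2.2]) hh
    linarith [s0 0]
  have e3 := confine_sin (fun s => (G (s, T₀)).im) (by fun_prop) 0 1 (-2)
    (fun x _ => (s0 x).ne') (by push_cast; linarith [e2.1]) (by push_cast; linarith)
  push_cast at e3
  have e4 := confine_sin (fun t => (G (1, t)).im + Real.pi / 2) (by fun_prop) T₁ T₀ 0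
    (fun x _ => by rw [Real.sin_add_pi_div_two]; exact (c1 x).ne')
    (by push_cast; linarith) (by push_cast; linarith)
  push_cast at e4
  linarith [e3.2, e4.1]

/-- Hedlund separation: a continuous, injective, proper curve `c` confined
to an open strip `{a < ⟨n, ·⟩ < b}` and exiting through both ends of the strip (in the
direction `h` parallel to the strip) separates the two boundary lines of the strip: every
continuous path from the line `⟨n, ·⟩ = a` to the line `⟨n, ·⟩ = b` meets the trace of `c`. -/
theorem strip_curve_separates (c : ℝ → ℝ × ℝ) (n h : ℝ × ℝ) (a b : ℝ)
    (hab : a < b) (hn : n ≠ 0) (hh : h ≠ 0) (horth : dot2 n h = 0)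
    (hc : Continuous c) (hinj : Function.Injective c)
    (hproper : Tendsto c (cocompact ℝ) (cocompact (ℝ × ℝ)))
    (hstrip : ∀ t, a < dot2 n (c t) ∧ dot2 n (c t) < b)
    (hendsTop : Tendsto (fun t => dot2 h (c t)) atTop atTop)
    (hendsBot : Tendsto (fun t => dot2 h (c t)) atBot atBot)
    (p : ℝ → ℝ × ℝ) (hp : ContinuousOn p (Icc 0 1))
    (hp0 : dot2 n (p 0) = a) (hp1 : dot2 n (p 1) = b) :
    ∃ t ∈ Icc (0 : ℝ) 1, p t ∈ Set.range c := by

  set q : ℝ → ℝ × ℝ := IccExtend zero_le_one ((Icc (0:ℝ) 1).domRestrict p) with hq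
  have hqc : Continuous q := (continuousOn_iff_continuous_domRestrict.1 hp).Icc_extend'
  have hqp : ∀ s, ∃ t ∈ Icc (0:ℝ) 1, q s = p t := fun s =>
    ⟨projIcc 0 1 zero_le_one s, (projIcc 0 1 zero_le_one s).2, rfl⟩
  have hq0 : q 0 = p 0 := by simp [hq, IccExtend]
  have hq1 : q 1 = p 1 := by simp [hq, IccExtend]
  have hdc : ∀ w : ℝ × ℝ, Continuous (fun x : ℝ × ℝ => dot2 w x) := fun w => by
    unfold dot2; fun_prop
  have hcomp : IsCompact ((fun t => dot2 h (p t)) '' Icc 0 1) :=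
    isCompact_Icc.image_of_continuousOn ((hdc h).comp_continuousOn hp)
  obtain ⟨M, hM⟩ := hcomp.bddAbove
  obtain ⟨m, hm⟩ := hcomp.bddBelow
  have hMq : ∀ s, dot2 h (q s) ≤ M ∧ m ≤ dot2 h (q s) := fun s => by
    obtain ⟨t, ht, e⟩ := hqp s
    rw [e]
    exact ⟨hM ⟨t, ht, rfl⟩, hm ⟨t, ht, rfl⟩⟩
  obtain ⟨T₁, hT₁⟩ := (hendsTop.eventually_gt_atTop M).exists
  obtain ⟨T₀, hT₀⟩ := (hendsBot.eventually_lt_atBot m).exists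
  have h1 := (hdc n).comp hqc
  have h2 := (hdc h).comp hqc
  have h3 := (hdc n).comp hc
  have h4 := (hdc h).comp hc
  simp only [Function.comp_def] at h1 h2 h3 h4
  obtain ⟨z, hz⟩ := miranda
    (fun z => Complex.mk (dot2 n (q z.1) - dot2 n (c z.2)) (dot2 h (q z.1) - dot2 h (c z.2)))
    (by
      have : Continuous (fun z : ℝ × ℝ => Complex.equivRealProdCLM.symm
        (dot2 n (q z.1) - dot2 n (c z.2), dot2 h (q z.1) - dot2 h (c z.2))) := by
        refine Complex.equivRealProdCLM.symm.continuous.comp (Continuous.prodMk ?_ ?_)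
        · exact (h1.comp continuous_fst).sub (h3.comp continuous_snd)
        · exact (h2.comp continuous_fst).sub (h4.comp continuous_snd)
      convert this using 2
      apply Complex.ext <;> simp [Complex.equivRealProdCLM_symm_apply]) T₀ T₁
    (fun t => by simp only [hq0, hp0]; linarith [(hstrip t).1])
    (fun t => by simp only [hq1, hp1]; linarith [(hstrip t).2])
    (fun s => by simp only; linarith [(hMq s).2])
    (fun s => by simp only; linarith [(hMq s).1])
  obtain ⟨t, ht, e⟩ := hqp z.1
  refine ⟨t, ht, z.2, ?_⟩
  rw [← e]
  have r1 := congrArg Complex.re hz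
  have r2 := congrArg Complex.im hz
  simp only [Complex.zero_re, Complex.zero_im] at r1 r2
  clear hz
  generalize c z.2 = y at *
  generalize q z.1 = x at *
  obtain ⟨n1, n2⟩ := n
  obtain ⟨k1, k2⟩ := h
  obtain ⟨x1, x2⟩ := x
  obtain ⟨y1, y2⟩ := y
  simp only [dot2] at r1 r2 horth
  have hN : 0 < n1 ^ 2 + n2 ^ 2 := by
    rcases eq_or_ne n1 0 with r | r
    · have : n2 ≠ 0 := fun r' => hn (by simp [r, r'])
      positivity
    · positivity
  have hK : 0 < k1 ^ 2 + k2 ^ 2 := by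
    rcases eq_or_ne k1 0 with r | r
    · have : k2 ≠ 0 := fun r' => hh (by simp [r, r'])
      positivity
    · positivity
  have hdet : n1 * k2 - n2 * k1 ≠ 0 := fun hd => by
    have : (n1 ^ 2 + n2 ^ 2) * (k1 ^ 2 + k2 ^ 2) = 0 := by
      linear_combination (n1 * k1 + n2 * k2) * horth + (n1 * k2 - n2 * k1) * hd
    exact (mul_pos hN hK).ne' this
  have e1 : (n1 * k2 - n2 * k1) * (y1 - x1) = 0 := by
    linear_combination -k2 * r1 + n2 * r2
  have e2 : (n1 * k2 - n2 * k1) * (y2 - x2) = 0 := by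
    linear_combination k1 * r1 - n1 * r2
  have f1 := (mul_eq_zero.1 e1).resolve_left hdet
  have f2 := (mul_eq_zero.1 e2).resolve_left hdet
  exact Prod.ext (by simp only; linarith) (by simp only; linarith)
end
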